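/- arXiv:0704.0195 — 4 statements merged into one kernel-verified Lean document; each statement's English description precedes it below -/
import Mathlib

section
/- Let p be a prime number and (G,q) a nondegenerate metric group such that |G| = p^{2n} for some positive integer n, and suppose the Gauss sum satisfies ∑_{g∈G} q(g) = p^n (i.e., the central charge of (G,q) is 1). Then G contains a Lagrangian subgroup, i.e., a subgroup H with q(h) = 1 for all h ∈ H and H = H^⊥. -/
/-- The bimultiplicative form associated to a quadratic form `q` on a group:
`b(g,h) = q(g*h) * q(g)⁻¹ * q(h)⁻¹`. -/
def metricForm {G : Type*} [Group G] (q : G → ℂˣ) (g h : G) : ℂˣ :=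
  q (g * h) * (q g)⁻¹ * (q h)⁻¹

open Finset Polynomial

/-- If a finite sum of `N`-th roots of unity is a natural number, then raising every term to a
power coprime to `N` does not change the sum. -/
theorem sum_pow_eq_of_sum_eq_natCast {ι : Type*} [Fintype ι] {f : ι → ℂ} {N c k : ℕ} (hN : 0 < N)
    (hf : ∀ i, f i ^ N = 1) (hsum : ∑ i, f i = c) (hk : k.Coprime N) :
    ∑ i, f i ^ k = c := by
  have : NeZero N := ⟨hN.ne'⟩
  have hζ := Complex.isPrimitiveRoot_exp N hN.ne'
  set ζ := Complex.exp (2 * Real.pi * Complex.I / N)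
  choose e _ he using fun i => hζ.eq_pow_of_pow_eq_one (hf i)
  have hroot : aeval ζ (∑ i, X ^ e i - C (c : ℤ) : ℤ[X]) = 0 := by
    simp [he, hsum]
  have hdvd := minpoly.isIntegrallyClosed_dvd (hζ.isIntegral hN) hroot
  rw [hζ.minpoly_eq_pow_coprime hk] at hdvd
  have hroot' := aeval_eq_zero_of_dvd_aeval_eq_zero hdvd (minpoly.aeval ℤ (ζ ^ k))
  simpa [pow_right_comm ζ k, he, sub_eq_zero] using hroot'

/-- If all values of `f` are `N`-th roots of unity and only one of them is `1`, then the power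
sums of `f` of degree less than `N` add up to `N`. -/
theorem sum_range_sum_pow_eq {ι : Type*} [Fintype ι] {f : ι → ℂ} {N : ℕ} (i₀ : ι)
    (hf : ∀ i, f i ^ N = 1) (h₀ : f i₀ = 1) (h₁ : ∀ i, f i = 1 → i = i₀) :
    ∑ k ∈ range N, ∑ i, f i ^ k = N := by
  rw [sum_comm, sum_eq_single i₀]
  · simp [h₀]
  · intro i _ hi
    have h := mul_geom_sum (f i) N
    rw [hf, sub_self, mul_eq_zero, sub_eq_zero] at h
    exact h.resolve_left fun h => hi (h₁ i h)
  · simp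

/-- The sum of the values of a complex character of a finite group is the order of the group if
the character is trivial, and zero otherwise. -/
theorem sum_unitsHom_eq_ite {G : Type*} [Group G] [Fintype G] (χ : G →* ℂˣ)
    [Decidable (∀ g, χ g = 1)] :
    ∑ g, (χ g : ℂ) = if ∀ g, χ g = 1 then (Fintype.card G : ℂ) else 0 := by
  split_ifs with h
  · simp [h]
  · refine sum_hom_units_eq_zero ((Units.coeHom ℂ).comp χ) fun h' => h fun g => ?_
    exact Units.ext (DFunLike.congr_fun h' g)

/-- Summing a function over a group after pulling it back from a quotient. -/
theorem sum_comp_quotient_mk {G : Type*} [CommGroup G] [Fintype G] (H : Subgroup G)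
    [Fintype (G ⧸ H)] (f : G ⧸ H → ℂ) :
    ∑ g : G, f g = Nat.card H * ∑ a, f a := by
  classical
  rw [mul_sum, ← sum_fiberwise univ (fun g : G => (g : G ⧸ H))]
  refine sum_congr rfl fun a _ => ?_
  rw [sum_congr rfl fun g hg => by rw [(mem_filter.1 hg).2], sum_const, nsmul_eq_mul]
  congr 2
  refine (MonoidHom.card_fiber_eq_of_mem_range (QuotientGroup.mk' H)
    (QuotientGroup.mk'_surjective H a) ⟨1, map_one _⟩).trans ?_
  rw [Nat.card_eq_fintype_card, Fintype.card_subtype]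
  congr 1
  ext g
  simp

/-- `(G, q)` is a (possibly degenerate) metric group. -/
structure IsMetricGroup {G : Type*} [CommGroup G] (q : G → ℂˣ) : Prop where
  map_inv : ∀ g, q g⁻¹ = q g
  form_mul_left : ∀ g₁ g₂ h,
    metricForm q (g₁ * g₂) h = metricForm q g₁ h * metricForm q g₂ h

theorem metricForm_comm {G : Type*} [CommGroup G] (q : G → ℂˣ) (g h : G) :
    metricForm q g h = metricForm q h g := by
  rw [metricForm, metricForm, mul_comm g h, mul_right_comm]

theorem map_mul_eq_mul_metricForm {G : Type*} [CommGroup G] (q : G → ℂˣ) (g h : G) :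
    q (g * h) = q g * q h * metricForm q g h := by
  rw [metricForm, mul_assoc (q (g * h)), ← mul_inv, mul_comm (q g * q h), inv_mul_cancel_right]

namespace IsMetricGroup

variable {G : Type*} [CommGroup G] {q : G → ℂˣ}

/-- The form of a metric group as a character in its first argument. -/
def formHom (hq : IsMetricGroup q) (h : G) : G →* ℂˣ :=
  MonoidHom.mk' (fun g => metricForm q g h) fun g₁ g₂ => hq.form_mul_left g₁ g₂ h

theorem form_one_left (hq : IsMetricGroup q) (h : G) : metricForm q 1 h = 1 :=
  map_one (hq.formHom h)

theorem form_pow_left (hq : IsMetricGroup q) (g h : G) (n : ℕ) :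
    metricForm q (g ^ n) h = metricForm q g h ^ n :=
  map_pow (hq.formHom h) g n

theorem form_inv_left (hq : IsMetricGroup q) (g h : G) :
    metricForm q g⁻¹ h = (metricForm q g h)⁻¹ :=
  _root_.map_inv (hq.formHom h) g

theorem map_one (hq : IsMetricGroup q) : q 1 = 1 := by
  simpa [metricForm] using hq.form_one_left 1

theorem form_self (hq : IsMetricGroup q) (g : G) : metricForm q g g = q g ^ 2 := by
  have h := hq.form_inv_left g g
  rw [metricForm, inv_mul_cancel, hq.map_one, hq.map_inv, one_mul, ← mul_inv, inv_inj] at h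
  rw [← h, sq]

theorem map_pow (hq : IsMetricGroup q) (g : G) (n : ℕ) : q (g ^ n) = q g ^ n ^ 2 := by
  induction n with
  | zero => simp [hq.map_one]
  | succ n ih =>
    rw [pow_succ, map_mul_eq_mul_metricForm q, ih, hq.form_pow_left, hq.form_self, ← pow_succ,
      ← pow_mul, ← pow_add]
    ring_nf

theorem pow_two_mul_eq_one (hq : IsMetricGroup q) {g : G} {n : ℕ} (hg : g ^ n = 1) :
    q g ^ (2 * n) = 1 := by
  rw [pow_mul, ← hq.form_self, ← hq.form_pow_left, hg, hq.form_one_left]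

theorem pow_eq_one_of_odd (hq : IsMetricGroup q) {g : G} {n : ℕ} (hn : Odd n) (hg : g ^ n = 1) :
    q g ^ n = 1 := by
  have h₁ := hq.pow_two_mul_eq_one hg
  have h₂ : q g ^ (n * n) = 1 := by rw [← sq, ← hq.map_pow, hg, hq.map_one]
  have h := pow_gcd_eq_one.2 ⟨h₁, h₂⟩
  rwa [Nat.gcd_mul_right, (Nat.coprime_two_left.2 hn).gcd_eq_one, one_mul] at h

section Anisotropic

theorem pow_prime_eq_one_of_anisotropic (hq : IsMetricGroup q) (han : ∀ g, q g = 1 → g = 1)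
    {p : ℕ} (hp : Odd p) (g : G) (k : ℕ) (hg : g ^ p ^ (k + 1) = 1) : g ^ p = 1 := by
  induction k with
  | zero => simpa using hg
  | succ k ih =>
    refine ih (han _ ?_)
    rw [hq.map_pow]
    have h := hq.pow_eq_one_of_odd hp.pow hg
    rw [← pow_mul, show (k + 1) * 2 = k + 1 + 1 + k by ring, pow_add, pow_mul, h, one_pow]

theorem pow_four_eq_one_of_anisotropic (hq : IsMetricGroup q) (han : ∀ g, q g = 1 → g = 1)
    (g : G) (k : ℕ) (hg : g ^ 2 ^ (k + 2) = 1) : g ^ 4 = 1 := by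
  induction k with
  | zero => simpa using hg
  | succ k ih =>
    refine ih (han _ ?_)
    rw [hq.map_pow]
    have h := hq.pow_two_mul_eq_one hg
    rw [← pow_mul, show (k + 2) * 2 = 1 + (k + 1 + 2) + k by ring, pow_add, pow_add, pow_one,
      pow_mul, h, one_pow]

theorem sq_eq_one_of_anisotropic [Fintype G] (hq : IsMetricGroup q)
    (han : ∀ g, q g = 1 → g = 1) (hexp : ∀ g : G, g ^ 4 = 1) {c : ℕ} (hc : c ≠ 0)
    (hgauss : ∑ g, (q g : ℂ) = c) (x : G) : x ^ 2 = 1 := by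
  by_contra hx
  have h8 : ∀ g, q g ^ 8 = 1 := fun g => hq.pow_two_mul_eq_one (hexp g)
  have hsq : ∀ g, g ^ 2 ≠ 1 → (q g : ℂ) ^ 4 = -1 := by
    intro g hg
    have h1 : (q g : ℂ) ^ 4 ≠ 1 := fun h => hg <| han _ <| by
      rw [hq.map_pow]
      exact Units.ext (by simpa using h)
    have h2 : ((q g : ℂ) ^ 4) ^ 2 = 1 := by
      rw [← pow_mul, ← Units.val_pow_eq_pow_val, h8, Units.val_one]
    exact (sq_eq_one_iff.1 h2).resolve_left h1
  have h5 : ∑ g, (q g : ℂ) ^ 5 = c :=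
    sum_pow_eq_of_sum_eq_natCast (N := 8) (by norm_num)
      (fun g => by rw [← Units.val_pow_eq_pow_val, h8, Units.val_one]) hgauss (by norm_num)
  have hanti : ∀ g, (q (x ^ 2 * g) : ℂ) + (q (x ^ 2 * g) : ℂ) ^ 5 =
      -((q g : ℂ) + (q g : ℂ) ^ 5) := by
    intro g
    by_cases hg : g ^ 2 = 1
    · have hb : metricForm q (x ^ 2) g = 1 := by
        rw [hq.form_pow_left, metricForm_comm, ← hq.form_pow_left, hg, hq.form_one_left]
      have hmul : (q (x ^ 2 * g) : ℂ) = -q g := by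
        rw [map_mul_eq_mul_metricForm q, hb, hq.map_pow]
        push_cast
        rw [hsq x hx]
        ring
      rw [hmul]
      ring
    · have hg' : (x ^ 2 * g) ^ 2 ≠ 1 := by
        rwa [mul_pow, ← pow_mul, hexp, one_mul]
      rw [pow_succ _ 4, pow_succ _ 4, hsq _ hg, hsq _ hg']
      ring
  have hE : ∑ g, ((q g : ℂ) + (q g : ℂ) ^ 5) = 2 * c := by
    rw [sum_add_distrib, hgauss, h5]
    ring
  have hE' := Equiv.sum_comp (Equiv.mulLeft (x ^ 2)) fun g => (q g : ℂ) + (q g : ℂ) ^ 5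
  simp only [Equiv.coe_mulLeft, hanti, sum_neg_distrib, hE] at hE'
  have : (c : ℂ) = 0 := by linear_combination -hE' / 4
  exact hc (by exact_mod_cast this)

theorem gauss_eq_one_of_anisotropic_odd [Fintype G] (hq : IsMetricGroup q)
    (han : ∀ g, q g = 1 → g = 1) {p : ℕ} (hp : p.Prime) (hodd : Odd p)
    (hexp : ∀ g : G, g ^ p = 1) {c : ℕ} (hcard : Fintype.card G = c ^ 2)
    (hgauss : ∑ g, (q g : ℂ) = c) : c = 1 := by
  have hroot : ∀ g, (q g : ℂ) ^ p = 1 := fun g => by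
    rw [← Units.val_pow_eq_pow_val, hq.pow_eq_one_of_odd hodd (hexp g), Units.val_one]
  have hsum := sum_range_sum_pow_eq (f := fun g => (q g : ℂ)) 1 hroot (by simp [hq.map_one])
    fun g hg => han g (Units.ext hg)
  obtain ⟨m, rfl⟩ : ∃ m, p = m + 1 := ⟨p - 1, (Nat.sub_add_cancel hp.one_le).symm⟩
  have hpow : ∀ k ∈ range m, ∑ g, (q g : ℂ) ^ (k + 1) = c := fun k hk =>
    sum_pow_eq_of_sum_eq_natCast hp.pos hroot hgauss
      (Nat.coprime_of_lt_prime k.succ_ne_zero (by simpa using hk) hp).symm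
  rw [sum_range_succ', sum_congr rfl hpow] at hsum
  simp only [sum_const, card_range, nsmul_eq_mul, pow_zero, card_univ, hcard, mul_one] at hsum
  have h : m * c + c ^ 2 = m + 1 := by exact_mod_cast hsum
  have hfac : ((c : ℤ) - 1) * (c + m + 1) = 0 := by
    zify at h
    linear_combination h
  rcases mul_eq_zero.1 hfac with h | h <;> lia

theorem gauss_eq_one_of_anisotropic_two [Fintype G] (hq : IsMetricGroup q)
    (han : ∀ g, q g = 1 → g = 1) (hexp : ∀ g : G, g ^ 2 = 1) {c : ℕ}
    (hcard : Fintype.card G = c ^ 2) (hgauss : ∑ g, (q g : ℂ) = c) : c = 1 := by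
  classical
  have hroot : ∀ g, (q g : ℂ) ^ 4 = 1 := fun g => by
    rw [← Units.val_pow_eq_pow_val, hq.pow_two_mul_eq_one (hexp g), Units.val_one]
  have hsum := sum_range_sum_pow_eq (f := fun g => (q g : ℂ)) 1 hroot (by simp [hq.map_one])
    fun g hg => han g (Units.ext hg)
  have h3 := sum_pow_eq_of_sum_eq_natCast (k := 3) (by norm_num) hroot hgauss (by norm_num)
  let χ : G →* ℂˣ := MonoidHom.mk' (fun g => q g ^ 2) fun g h => by
    rw [map_mul_eq_mul_metricForm q, mul_pow, mul_pow, ← hq.form_pow_left, hexp, hq.form_one_left,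
      mul_one]
  have h2 : ∑ g, (q g : ℂ) ^ 2 = if ∀ g, χ g = 1 then (Fintype.card G : ℂ) else 0 := by
    rw [← sum_unitsHom_eq_ite χ]
    simp [χ]
  simp only [sum_range_succ, range_zero, sum_empty, pow_zero, pow_one, h3, h2, hgauss, sum_const,
    card_univ, hcard, nsmul_eq_mul, mul_one, zero_add] at hsum
  have h : c ^ 2 + c + (if ∀ g, χ g = 1 then c ^ 2 else 0) + c = 4 := by
    split_ifs at hsum ⊢ <;> exact_mod_cast hsum
  have hc : c < 2 := by
    by_contra! hc
    nlinarith [Nat.zero_le (if ∀ g, χ g = 1 then c ^ 2 else 0)]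
  interval_cases c
  · simp at h
  · rfl

theorem gauss_eq_one_of_anisotropic [Fintype G] (hq : IsMetricGroup q)
    (han : ∀ g, q g = 1 → g = 1) {p m : ℕ} (hp : p.Prime)
    (hcard : Fintype.card G = (p ^ m) ^ 2) (hgauss : ∑ g, (q g : ℂ) = (p ^ m : ℕ)) :
    p ^ m = 1 := by
  have hpow : ∀ (g : G) (j : ℕ), g ^ p ^ (m * 2 + j) = 1 := fun g j => by
    rw [pow_add, pow_mul, pow_mul p, ← hcard, pow_card_eq_one, one_pow]
  rcases hp.eq_two_or_odd' with rfl | hodd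
  · have hexp := hq.sq_eq_one_of_anisotropic han
      (fun g => hq.pow_four_eq_one_of_anisotropic han g _ (hpow g 2)) (by positivity) hgauss
    exact hq.gauss_eq_one_of_anisotropic_two han hexp hcard hgauss
  · exact hq.gauss_eq_one_of_anisotropic_odd han hp hodd
      (fun g => hq.pow_prime_eq_one_of_anisotropic han hodd g _ (hpow g 1)) hcard hgauss

end Anisotropic

section Orthogonal

/-- The orthogonal complement of a subgroup of a metric group. -/
def orthogonal (hq : IsMetricGroup q) (H : Subgroup G) : Subgroup G where
  carrier := {g | ∀ h ∈ H, metricForm q g h = 1}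
  one_mem' h _ := hq.form_one_left h
  mul_mem' ha hb h hh := by rw [hq.form_mul_left, ha h hh, hb h hh, one_mul]
  inv_mem' ha h hh := by rw [hq.form_inv_left, ha h hh, inv_one]

theorem mem_orthogonal (hq : IsMetricGroup q) {H : Subgroup G} {g : G} :
    g ∈ hq.orthogonal H ↔ ∀ h ∈ H, metricForm q g h = 1 :=
  Iff.rfl

theorem le_orthogonal (hq : IsMetricGroup q) {H : Subgroup G} (hH : ∀ h ∈ H, q h = 1) :
    H ≤ hq.orthogonal H := fun g hg h hh => by
  simp [metricForm, hH g hg, hH h hh, hH _ (mul_mem hg hh)]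

theorem sum_form_subgroup [Finite G] (hq : IsMetricGroup q) (H : Subgroup G) [Fintype H] (g : G)
    [Decidable (g ∈ hq.orthogonal H)] :
    ∑ h : H, (metricForm q g h : ℂ) = if g ∈ hq.orthogonal H then (Nat.card H : ℂ) else 0 := by
  classical
  have h := sum_unitsHom_eq_ite ((hq.formHom g).comp H.subtype)
  have hiff : (∀ h, ((hq.formHom g).comp H.subtype) h = 1) ↔ g ∈ hq.orthogonal H := by
    simp [mem_orthogonal, formHom, metricForm_comm q g]
  simp only [hiff, ← Nat.card_eq_fintype_card] at h
  rw [← h]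
  simp [formHom, metricForm_comm q g]

theorem card_orthogonal_mul_card [Fintype G] (hq : IsMetricGroup q)
    (hnd : ∀ g : G, (∀ h : G, metricForm q g h = 1) → g = 1) (H : Subgroup G) :
    Nat.card (hq.orthogonal H) * Nat.card H = Fintype.card G := by
  classical
  have hleft : ∑ g : G, ∑ h : H, (metricForm q g h : ℂ) =
      Nat.card (hq.orthogonal H) * Nat.card H := by
    simp only [hq.sum_form_subgroup, ← sum_filter, sum_const, nsmul_eq_mul]
    rw [Nat.card_eq_fintype_card (α := hq.orthogonal H), Fintype.card_subtype]
  have hright : ∑ h : H, ∑ g : G, (metricForm q g h : ℂ) = Fintype.card G := by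
    have hsum : ∀ h : H, ∑ g : G, (metricForm q g h : ℂ) =
        if h = 1 then (Fintype.card G : ℂ) else 0 := by
      intro h
      have hiff : (∀ g, hq.formHom h g = 1) ↔ h = 1 := by
        refine ⟨fun hh => Subtype.ext (hnd _ fun g => ?_), ?_⟩
        · rw [metricForm_comm]
          exact hh g
        · rintro rfl g
          exact (metricForm_comm q g 1).trans (hq.form_one_left g)
      rw [← if_congr hiff rfl rfl, ← sum_unitsHom_eq_ite]
      rfl
    simp [hsum]
  rw [sum_comm, hright] at hleft
  exact_mod_cast hleft.symm

theorem sum_orthogonal_eq_sum [Fintype G] (hq : IsMetricGroup q) {H : Subgroup G}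
    [Fintype (hq.orthogonal H)] (hH : ∀ h ∈ H, q h = 1) :
    ∑ g : hq.orthogonal H, (q g : ℂ) = ∑ g, (q g : ℂ) := by
  classical
  have hshift : ∀ h : H, ∑ g, (q g : ℂ) * metricForm q g h = ∑ g, (q g : ℂ) := fun h => by
    rw [← Equiv.sum_comp (Equiv.mulRight (h : G)) fun g => (q g : ℂ)]
    simp [map_mul_eq_mul_metricForm q, hH h h.2]
  have hsum : ∑ h : H, ∑ g, (q g : ℂ) * metricForm q g h = Nat.card H * ∑ g, (q g : ℂ) := by
    simp [hshift]
  rw [sum_comm] at hsum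
  simp only [← mul_sum, hq.sum_form_subgroup, mul_ite, mul_zero, ← sum_filter, ← sum_mul] at hsum
  rw [mul_comm, mul_right_inj' (by exact_mod_cast Nat.card_pos.ne')] at hsum
  rw [← hsum]
  exact (sum_subtype {g | g ∈ hq.orthogonal H} (fun g => by simp) fun g => (q g : ℂ)).symm

theorem mem_of_maximal_isotropic (hq : IsMetricGroup q) {H : Subgroup G}
    (hH : Maximal (fun H : Subgroup G => ∀ h ∈ H, q h = 1) H) {x : G}
    (hx : x ∈ hq.orthogonal H) (hqx : q x = 1) : x ∈ H := by
  have hpow : ∀ k : ℕ, q (x ^ k) = 1 := fun k => by rw [hq.map_pow, hqx, one_pow]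
  have hzpow : ∀ k : ℤ, q (x ^ k) = 1 := by
    rintro (k | k)
    · simpa using hpow k
    · rw [zpow_negSucc, hq.map_inv, hpow]
  refine hH.le_of_ge (y := H ⊔ Subgroup.zpowers x) ?_ le_sup_left
    (le_sup_right (a := H) (Subgroup.mem_zpowers x))
  intro y hy
  obtain ⟨h, hh, z, ⟨k, rfl⟩, rfl⟩ := Subgroup.mem_sup.1 hy
  have hform := hq.mem_orthogonal.1 (zpow_mem hx k) h hh
  simp only at hform ⊢
  rw [map_mul_eq_mul_metricForm q, metricForm_comm, hform, hH.prop h hh, hzpow, one_mul, one_mul]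

/-- The quadratic form induced on the subquotient `H^⊥ / H` for an isotropic subgroup `H`. -/
def reduction (hq : IsMetricGroup q) {H : Subgroup G} (hH : ∀ h ∈ H, q h = 1) :
    hq.orthogonal H ⧸ H.subgroupOf (hq.orthogonal H) → ℂˣ :=
  Quotient.lift (fun g => q g) fun a b hab => by
    have hmem : (a : G)⁻¹ * b ∈ H := by
      simpa [Subgroup.mem_subgroupOf] using QuotientGroup.leftRel_apply.1 hab
    have h := map_mul_eq_mul_metricForm q (a : G) ((a : G)⁻¹ * b)
    rw [mul_inv_cancel_left, hH _ hmem, a.2 _ hmem, mul_one, mul_one] at h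
    exact h.symm

theorem reduction_mk (hq : IsMetricGroup q) {H : Subgroup G} (hH : ∀ h ∈ H, q h = 1)
    (g : hq.orthogonal H) : hq.reduction hH g = q g :=
  rfl

theorem isMetricGroup_reduction (hq : IsMetricGroup q) {H : Subgroup G}
    (hH : ∀ h ∈ H, q h = 1) : IsMetricGroup (hq.reduction hH) where
  map_inv a := by
    induction a using QuotientGroup.induction_on with
    | H g => exact hq.map_inv g
  form_mul_left a b c := by
    induction a using QuotientGroup.induction_on with
    | H a =>
      induction b using QuotientGroup.induction_on with
      | H b =>
        induction c using QuotientGroup.induction_on with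
        | H c => exact hq.form_mul_left a b c

end Orthogonal

end IsMetricGroup

/-- If `(G, q)` is a nondegenerate metric group with `|G| = p^(2n)`
(`p` prime, `n > 0`) and Gauss sum `∑ q(g) = p^n` (central charge 1), then `G`
contains a Lagrangian subgroup: an isotropic subgroup equal to its own orthogonal
complement. -/
theorem metric_group_central_charge_one_has_lagrangian
    {G : Type*} [CommGroup G] [Fintype G] (q : G → ℂˣ)
    (hq1 : ∀ g : G, q g⁻¹ = q g)
    (hq2 : ∀ g₁ g₂ h : G, metricForm q (g₁ * g₂) h = metricForm q g₁ h * metricForm q g₂ h)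
    (hnd : ∀ g : G, (∀ h : G, metricForm q g h = 1) → g = 1)
    (p n : ℕ) (hp : p.Prime) (hn : 0 < n)
    (hcard : Fintype.card G = p ^ (2 * n))
    (hgauss : ∑ g : G, (q g : ℂ) = (p : ℂ) ^ n) :
    ∃ H : Subgroup G, (∀ h ∈ H, q h = 1) ∧
      (H : Set G) = {g : G | ∀ h ∈ H, metricForm q g h = 1} := by
  classical
  have hq : IsMetricGroup q := ⟨hq1, hq2⟩
  obtain ⟨H, hmax⟩ := Set.Finite.exists_maximal
    (Set.toFinite {H : Subgroup G | ∀ h ∈ H, q h = 1}) ⟨⊥, by simp [hq.map_one]⟩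
  have hH : ∀ h ∈ H, q h = 1 := hmax.prop
  have hle := hq.le_orthogonal hH
  have hcardH : Nat.card (H.subgroupOf (hq.orthogonal H)) = Nat.card H :=
    Nat.card_congr (Subgroup.subgroupOfEquivOfLe hle).toEquiv
  have horth := hq.card_orthogonal_mul_card hnd H
  have hquot := (H.subgroupOf (hq.orthogonal H)).card_eq_card_quotient_mul_card_subgroup
  obtain ⟨a, -, ha⟩ := (Nat.dvd_prime_pow hp).1
    (hcard ▸ Nat.card_eq_fintype_card (α := G) ▸ H.card_subgroup_dvd_card)
  rw [hquot, hcardH, ha, hcard] at horth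
  have hpos : 0 < p := hp.pos
  have han : n = a + (n - a) := by
    have hdvd : p ^ (2 * a) ∣ p ^ (2 * n) := ⟨_, by rw [← horth]; ring⟩
    have := (Nat.pow_dvd_pow_iff_le_right hp.one_lt).1 hdvd
    lia
  set m := n - a
  have hcardA : Fintype.card (hq.orthogonal H ⧸ H.subgroupOf (hq.orthogonal H)) =
      (p ^ m) ^ 2 := by
    rw [← Nat.card_eq_fintype_card]
    refine Nat.eq_of_mul_eq_mul_right (pow_pos hpos (2 * a)) ?_
    calc _ = _ := by rw [two_mul, pow_add, ← mul_assoc]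
      _ = _ := horth
      _ = _ := by rw [han]; ring
  have hsum := sum_comp_quotient_mk (H.subgroupOf (hq.orthogonal H))
    fun x => (hq.reduction hH x : ℂ)
  simp only [hq.reduction_mk, hq.sum_orthogonal_eq_sum hH, hgauss, hcardH, ha] at hsum
  rw [han, pow_add, Nat.cast_pow, mul_right_inj' (by exact_mod_cast (pow_pos hpos a).ne')] at hsum
  have hone := (hq.isMetricGroup_reduction hH).gauss_eq_one_of_anisotropic (fun x hx => by
    induction x using QuotientGroup.induction_on with
    | H x =>
      rw [QuotientGroup.eq_one_iff]
      exact hq.mem_of_maximal_isotropic hmax x.2 hx) hp hcardA (by rw [← hsum]; push_cast; rfl)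
  rw [hone, one_pow, Fintype.card_eq_one_iff_nonempty_unique] at hcardA
  obtain ⟨_⟩ := hcardA
  refine ⟨H, hH, Set.Subset.antisymm hle fun g hg => ?_⟩
  exact (QuotientGroup.eq_one_iff (N := H.subgroupOf (hq.orthogonal H)) ⟨g, hg⟩).1
    (Subsingleton.elim _ _)
end

section
/- Let p be an odd prime, (G,q) a metric group, and x ∈ G an element of order p^k with k ≥ 2. Then q(x^{p^{k-1}}) = 1; consequently the cyclic subgroup generated by x^{p^{k-1}} is a nontrivial isotropic subgroup of G of order p. -/
/-- A form `q` whose associated form is multiplicative sends `1` to `1`. -/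
theorem map_one_of_metricForm_mul {G : Type*} [CommGroup G] {q : G → ℂˣ}
    (hq2 : ∀ g₁ g₂ h : G, metricForm q (g₁ * g₂) h = metricForm q g₁ h * metricForm q g₂ h) :
    q 1 = 1 := by
  have h := hq2 1 1 1
  simpa [metricForm] using h

theorem metricForm_one_left {G : Type*} [CommGroup G] {q : G → ℂˣ}
    (hq2 : ∀ g₁ g₂ h : G, metricForm q (g₁ * g₂) h = metricForm q g₁ h * metricForm q g₂ h)
    (h : G) : metricForm q 1 h = 1 := by
  simp [metricForm, map_one_of_metricForm_mul hq2]

theorem metricForm_pow_left {G : Type*} [CommGroup G] {q : G → ℂˣ}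
    (hq2 : ∀ g₁ g₂ h : G, metricForm q (g₁ * g₂) h = metricForm q g₁ h * metricForm q g₂ h)
    (g h : G) (n : ℕ) : metricForm q (g ^ n) h = metricForm q g h ^ n := by
  induction n with
  | zero => simp [metricForm_one_left hq2]
  | succ n ih => rw [pow_succ, hq2, ih, pow_succ]

theorem metricForm_self {G : Type*} [CommGroup G] {q : G → ℂˣ}
    (hq1 : ∀ g : G, q g⁻¹ = q g)
    (hq2 : ∀ g₁ g₂ h : G, metricForm q (g₁ * g₂) h = metricForm q g₁ h * metricForm q g₂ h)
    (g : G) : metricForm q g g = q g ^ 2 := by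
  have h := hq2 g⁻¹ g g
  have hinv : metricForm q g⁻¹ g = (q g ^ 2)⁻¹ := by
    simp [metricForm, map_one_of_metricForm_mul hq2, hq1, pow_two]
  rw [inv_mul_cancel, metricForm_one_left hq2, hinv] at h
  exact (inv_mul_eq_one.mp h.symm).symm

/-- The form `q` is quadratic along powers: `q(gⁿ) = q(g)^(n²)`. -/
theorem map_pow_of_metricForm_mul {G : Type*} [CommGroup G] {q : G → ℂˣ}
    (hq1 : ∀ g : G, q g⁻¹ = q g)
    (hq2 : ∀ g₁ g₂ h : G, metricForm q (g₁ * g₂) h = metricForm q g₁ h * metricForm q g₂ h)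
    (g : G) (n : ℕ) : q (g ^ n) = q g ^ n ^ 2 := by
  induction n with
  | zero => simp [map_one_of_metricForm_mul hq2]
  | succ n ih =>
    have h := metricForm_pow_left hq2 g g n
    rw [metricForm_self hq1 hq2, metricForm, ← pow_succ, ih, mul_inv_eq_iff_eq_mul,
      mul_inv_eq_iff_eq_mul] at h
    rw [h, ← pow_mul, ← pow_succ, ← pow_add]
    congr 1
    ring

/-- The value of `q` at an element killed by an odd `n` is an `n`-th root of unity. -/
theorem pow_eq_one_of_metricForm_mul {G : Type*} [CommGroup G] {q : G → ℂˣ}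
    (hq1 : ∀ g : G, q g⁻¹ = q g)
    (hq2 : ∀ g₁ g₂ h : G, metricForm q (g₁ * g₂) h = metricForm q g₁ h * metricForm q g₂ h)
    {g : G} {n : ℕ} (hn : Odd n) (hg : g ^ n = 1) : q g ^ n = 1 := by
  have hdouble : (q g ^ n) ^ 2 = 1 := by
    rw [← pow_mul, mul_comm, pow_mul, ← metricForm_self hq1 hq2, ← metricForm_pow_left hq2, hg,
      metricForm_one_left hq2]
  have hsq : (q g ^ n) ^ n = 1 := by
    rw [← pow_mul, ← pow_two, ← map_pow_of_metricForm_mul hq1 hq2, hg,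
      map_one_of_metricForm_mul hq2]
  have hgcd := pow_gcd_eq_one.mpr ⟨hdouble, hsq⟩
  rwa [Nat.coprime_two_left.mpr hn, pow_one] at hgcd

/-- Let `p` be an odd prime, `(G,q)` a metric group and `x ∈ G` an
element of order `p^k` with `k ≥ 2`. Then `q(x^(p^(k-1))) = 1`, so the cyclic
subgroup generated by `x^(p^(k-1))` is a nontrivial isotropic subgroup of order `p`. -/
theorem isotropic_element_in_odd_prime_power_order
    {G : Type*} [CommGroup G] (q : G → ℂˣ)
    (hq1 : ∀ g : G, q g⁻¹ = q g)
    (hq2 : ∀ g₁ g₂ h : G, metricForm q (g₁ * g₂) h = metricForm q g₁ h * metricForm q g₂ h)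
    (p k : ℕ) (hp : p.Prime) (hodd : Odd p) (hk : 2 ≤ k)
    (x : G) (hx : orderOf x = p ^ k) :
    q (x ^ p ^ (k - 1)) = 1 ∧
    (∀ h ∈ Subgroup.zpowers (x ^ p ^ (k - 1)), q h = 1) ∧
    Subgroup.zpowers (x ^ p ^ (k - 1)) ≠ ⊥ ∧
    Nat.card ↥(Subgroup.zpowers (x ^ p ^ (k - 1))) = p := by
  have hcard : orderOf (x ^ p ^ (k - 1)) = p := by
    have hk' : p ^ k = p ^ (k - 1) * p := by rw [← pow_succ]; congr 1; omega
    have hpos : 0 < p ^ (k - 1) := pow_pos hp.pos _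
    rw [orderOf_pow_of_dvd hpos.ne' (hx ▸ pow_dvd_pow p (Nat.sub_le k 1)), hx, hk',
      Nat.mul_div_cancel_left _ hpos]
  have hroot : q x ^ p ^ k = 1 :=
    pow_eq_one_of_metricForm_mul hq1 hq2 hodd.pow (hx ▸ pow_orderOf_eq_one x)
  have hq : q (x ^ p ^ (k - 1)) = 1 := by
    rw [map_pow_of_metricForm_mul hq1 hq2, ← pow_mul]
    obtain ⟨c, hc⟩ := pow_dvd_pow p (show k ≤ (k - 1) * 2 by omega)
    rw [hc, pow_mul, hroot, one_pow]
  refine ⟨hq, ?_, ?_, by rw [Nat.card_zpowers, hcard]⟩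
  · rintro _ ⟨m, rfl⟩
    obtain ⟨n, rfl | rfl⟩ := m.eq_nat_or_neg <;>
      simp only [zpow_neg, zpow_natCast, hq1, map_pow_of_metricForm_mul hq1 hq2 (x ^ p ^ (k - 1)),
        hq, one_pow]
  · rw [Subgroup.zpowers_ne_bot, ne_eq, ← orderOf_eq_one_iff, hcard]
    exact hp.ne_one
end

section
/- Let q make the cyclic group ℤ/4ℤ into a nondegenerate metric group and set σ = q(1). Then σ⁴ = −1 (so σ is a primitive 8th root of unity) and the Gauss sum satisfies ∑_{a ∈ ℤ/4ℤ} q(a) = 2σ; in particular the central charge of (ℤ/4ℤ, q) is σ. -/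
/-- Let `q` make `ℤ/4ℤ` into a nondegenerate metric group and set
`σ = q(1)`. Then `σ⁴ = -1` (so `σ` is a primitive 8th root of unity) and the Gauss
sum is `∑_a q(a) = 2σ`; in particular the central charge of `(ℤ/4ℤ, q)` is `σ`. -/
theorem zmod_four_gauss_sum
    (q : Multiplicative (ZMod 4) → ℂˣ)
    (hq1 : ∀ g, q g⁻¹ = q g)
    (hq2 : ∀ g₁ g₂ h, metricForm q (g₁ * g₂) h = metricForm q g₁ h * metricForm q g₂ h)
    (hnd : ∀ g, (∀ h, metricForm q g h = 1) → g = 1) :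
    ((q (Multiplicative.ofAdd (1 : ZMod 4)) : ℂ)) ^ 4 = -1 ∧
    (∑ a : Multiplicative (ZMod 4), (q a : ℂ))
      = 2 * (q (Multiplicative.ofAdd (1 : ZMod 4)) : ℂ) := by
  have cast_form (x y z : ZMod 4) (hxy : x + y = z) :
      ((metricForm q (.ofAdd x) (.ofAdd y) : ℂˣ) : ℂ) =
        q (.ofAdd z) * (q (.ofAdd x) : ℂ)⁻¹ * (q (.ofAdd y) : ℂ)⁻¹ := by
    subst hxy
    simp [metricForm]
  have form_add (x y z w : ZMod 4) (hxy : x + y = z) :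
      ((metricForm q (.ofAdd z) (.ofAdd w) : ℂˣ) : ℂ) =
        metricForm q (.ofAdd x) (.ofAdd w) * metricForm q (.ofAdd y) (.ofAdd w) := by
    subst hxy
    exact_mod_cast hq2 (.ofAdd x) (.ofAdd y) (.ofAdd w)
  have q_zero : (q (.ofAdd 0) : ℂ) = 1 := by
    have h := form_add 0 0 0 0 rfl
    rw [cast_form 0 0 0 rfl] at h
    have h0 := (q (.ofAdd 0)).ne_zero
    field_simp at h
    exact h
  have q_three : (q (.ofAdd 3) : ℂ) = q (.ofAdd 1) :=
    congrArg Units.val (hq1 (.ofAdd 1))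
  have h1 := (q (.ofAdd 1)).ne_zero
  have h2 := (q (.ofAdd 2)).ne_zero
  have cube_eq : (q (.ofAdd 2) : ℂ) ^ 3 = (q (.ofAdd 1) : ℂ) ^ 4 := by
    have h := form_add 1 1 2 1 rfl
    rw [cast_form 2 1 3 rfl, cast_form 1 1 2 rfl, q_three] at h
    field_simp at h
    linear_combination -h
  have sq_eq : (q (.ofAdd 2) : ℂ) ^ 2 = 1 := by
    have h := form_add 2 2 0 1 rfl
    rw [cast_form 0 1 1 rfl, cast_form 2 1 3 rfl, q_three, q_zero] at h
    field_simp at h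
    linear_combination h
  have q_two : (q (.ofAdd 2) : ℂ) = -1 := by
    refine (sq_eq_sq_iff_eq_or_eq_neg.mp (sq_eq.trans (one_pow 2).symm)).resolve_left fun hc => ?_
    have two_eq : Multiplicative.ofAdd (2 : ZMod 4) = 1 := by
      refine hnd _ fun h => Units.ext ?_
      obtain ⟨y, rfl⟩ := Multiplicative.ofAdd.surjective h
      fin_cases y
      · exact (cast_form 2 0 2 rfl).trans (by rw [hc, q_zero]; simp)
      · exact (cast_form 2 1 3 rfl).trans (by simp [hc, q_three])
      · exact (cast_form 2 2 0 rfl).trans (by rw [hc, q_zero]; simp)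
      · exact (cast_form 2 3 1 rfl).trans (by simp [hc, q_three])
    exact absurd two_eq (by decide)
  refine ⟨by rw [← cube_eq, q_two]; norm_num, ?_⟩
  have sum_eq : (∑ a : Multiplicative (ZMod 4), (q a : ℂ)) =
      q (.ofAdd 0) + q (.ofAdd 1) + q (.ofAdd 2) + q (.ofAdd 3) :=
    (Equiv.sum_comp Multiplicative.ofAdd fun a => (q a : ℂ)).symm.trans
      (Fin.sum_univ_four _)
  rw [sum_eq, q_zero, q_two, q_three]
  ring
end

section
/- Let p be an odd prime and (G,q) a nondegenerate metric group where G is a p-group. If p ≡ 1 (mod 4) then (∑_{g∈G} q(g))² = |G| (the central charge is ±1); if p ≡ 3 (mod 4) then (∑_{g∈G} q(g))⁴ = |G|² (the central charge is ±1 or ±i). -/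
/-- The bimultiplicative form of a metric group, bundled as a homomorphism in both variables. -/
def metricFormHom {G : Type*} [CommGroup G] (q : G → ℂˣ)
    (hq : ∀ g₁ g₂ h : G, metricForm q (g₁ * g₂) h = metricForm q g₁ h * metricForm q g₂ h) :
    G →* G →* ℂˣ :=
  MonoidHom.mk' (fun g => MonoidHom.mk' (metricForm q g) fun h₁ h₂ => by
    have comm : ∀ h, metricForm q g h = metricForm q h g := fun h => by
      simp only [metricForm, mul_comm g h, mul_right_comm]
    rw [comm, comm, comm, hq]) fun g₁ g₂ => by
    ext h
    simp [hq]

section MetricGroup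

variable {G : Type*} [CommGroup G] {q : G → ℂˣ} {B : G →* G →* ℂˣ}

theorem quadratic_one (hB : ∀ g h, q (g * h) = q g * q h * B g h) : q 1 = 1 := by
  simpa using hB 1 1

theorem polar_self (hB : ∀ g h, q (g * h) = q g * q h * B g h) (hinv : ∀ g, q g⁻¹ = q g)
    (g : G) : B g g = q g ^ 2 := by
  have h := hB g⁻¹ g
  rw [inv_mul_cancel, quadratic_one hB, hinv, map_inv, MonoidHom.inv_apply] at h
  rw [sq, ← mul_inv_eq_one, ← inv_inj, mul_inv_rev, inv_inv, inv_one, ← h]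

theorem quadratic_pow (hB : ∀ g h, q (g * h) = q g * q h * B g h) (hinv : ∀ g, q g⁻¹ = q g)
    (g : G) (n : ℕ) : q (g ^ n) = q g ^ n ^ 2 := by
  induction n with
  | zero => simp [quadratic_one hB]
  | succ n ih =>
    rw [pow_succ, hB, ih, map_pow, MonoidHom.pow_apply, polar_self hB hinv, ← pow_mul,
      ← pow_succ, ← pow_add]
    congr 1
    ring

theorem quadratic_pow_eq_inv [Fintype G] (hB : ∀ g h, q (g * h) = q g * q h * B g h)
    (hinv : ∀ g, q g⁻¹ = q g) {l : ℕ} (hl : Fintype.card G ^ 2 ∣ l + 1) (g : G) :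
    q g ^ l = (q g)⁻¹ := by
  obtain ⟨c, hc⟩ := hl
  rw [eq_inv_iff_mul_eq_one, ← pow_succ, hc, pow_mul, ← quadratic_pow hB hinv, pow_card_eq_one,
    quadratic_one hB, one_pow]

theorem pow_eq_inv_of_card_sq_dvd [Fintype G] {l : ℕ} (hl : Fintype.card G ^ 2 ∣ l + 1) (g : G) :
    g ^ l = g⁻¹ := by
  obtain ⟨c, hc⟩ := hl
  rw [eq_inv_iff_mul_eq_one, ← pow_succ, hc, sq, mul_assoc, pow_mul, pow_card_eq_one, one_pow]

/-- The Gauss sums of a nondegenerate metric group and of its inverse form multiply to `|G|`. -/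
theorem gauss_sum_mul_gauss_sum_inv [Fintype G] (hB : ∀ g h, q (g * h) = q g * q h * B g h)
    (hnd : ∀ g, (∀ h, B g h = 1) → g = 1) :
    (∑ g, (q g : ℂ)) * ∑ g, ((q g)⁻¹ : ℂˣ).val = Fintype.card G := by
  classical
  calc (∑ g, (q g : ℂ)) * ∑ g, ((q g)⁻¹ : ℂˣ).val
      = ∑ h, ∑ g, (q g : ℂ) * ((q h)⁻¹ : ℂˣ).val := by
        rw [Finset.sum_mul_sum, Finset.sum_comm]
    _ = ∑ h, ∑ k, (q k : ℂ) * (B k h : ℂ) := by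
        refine Finset.sum_congr rfl fun h _ => ?_
        rw [← Equiv.sum_comp (Equiv.mulRight h)]
        refine Finset.sum_congr rfl fun k _ => ?_
        rw [Equiv.coe_mulRight, hB, ← Units.val_mul, ← Units.val_mul, mul_right_comm,
          mul_inv_cancel_right]
    _ = ∑ k, (q k : ℂ) * ∑ h, (B k h : ℂ) := by
        rw [Finset.sum_comm]
        simp only [Finset.mul_sum]
    _ = ∑ k : G, if k = 1 then (Fintype.card G : ℂ) else 0 := by
        refine Finset.sum_congr rfl fun k _ => ?_
        split_ifs with hk
        · subst hk
          simp [quadratic_one hB]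
        · have hne : (Units.coeHom ℂ).comp (B k) ≠ 1 := fun h => hk <| hnd k fun x =>
            Units.ext (DFunLike.congr_fun h x)
          have hsum := sum_hom_units_eq_zero _ hne
          simp only [MonoidHom.comp_apply, Units.coeHom_apply] at hsum
          rw [hsum, mul_zero]
    _ = Fintype.card G := by simp

theorem gauss_sum_eq_gauss_sum_inv [Fintype G] (hB : ∀ g h, q (g * h) = q g * q h * B g h)
    (hinv : ∀ g, q g⁻¹ = q g) {a : ℕ} (ha : Fintype.card G ^ 2 ∣ a ^ 2 + 1) :
    ∑ g, (q g : ℂ) = ∑ g, ((q g)⁻¹ : ℂˣ).val := by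
  have hinj : Function.Injective fun g : G => g ^ a := fun g h hgh => by
    have := congrArg (· ^ a) hgh
    simpa only [← pow_mul, ← sq, pow_eq_inv_of_card_sq_dvd ha, inv_inj] using this
  refine ((Function.Bijective.sum_comp (Finite.injective_iff_bijective.1 hinj)
    fun g => (q g : ℂ)).symm).trans (Finset.sum_congr rfl fun g _ => ?_)
  rw [quadratic_pow hB hinv, quadratic_pow_eq_inv hB hinv ha]

theorem gauss_sum_sq_eq_gauss_sum_inv_sq [Fintype G]
    (hB : ∀ g h, q (g * h) = q g * q h * B g h)
    (hinv : ∀ g, q g⁻¹ = q g) {a b : ℕ} (hab : Fintype.card G ^ 2 ∣ a ^ 2 + b ^ 2 + 1) :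
    (∑ g, (q g : ℂ)) ^ 2 = (∑ g, ((q g)⁻¹ : ℂˣ).val) ^ 2 := by
  let f : G × G → G × G := fun x => (x.1 ^ a * x.2 ^ b, x.1⁻¹ ^ b * x.2 ^ a)
  have hfst : ∀ x, (f x).1 ^ a * (f x).2⁻¹ ^ b = x.1⁻¹ := fun x => by
    rw [← pow_eq_inv_of_card_sq_dvd hab x.1]
    simp only [f, mul_pow, mul_inv, inv_pow, inv_inv, ← pow_mul, pow_add, sq, mul_comm b a]
    rw [mul_mul_mul_comm, mul_inv_cancel, mul_one]
  have hsnd : ∀ x, (f x).1 ^ b * (f x).2 ^ a = x.2⁻¹ := fun x => by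
    rw [← pow_eq_inv_of_card_sq_dvd hab]
    simp only [f, mul_pow, inv_pow, ← pow_mul, pow_add, sq, mul_comm b a]
    rw [mul_mul_mul_comm, mul_inv_cancel, one_mul, mul_comm]
  have hinj : Function.Injective f := fun x y hxy =>
    Prod.ext (inv_injective (by rw [← hfst, ← hfst, hxy]))
      (inv_injective (by rw [← hsnd, ← hsnd, hxy]))
  have hf : ∀ x, q (f x).1 * q (f x).2 = (q x.1)⁻¹ * (q x.2)⁻¹ := fun x => by
    rw [← quadratic_pow_eq_inv hB hinv hab, ← quadratic_pow_eq_inv hB hinv hab]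
    simp only [f, hB, quadratic_pow hB hinv, hinv, map_pow, map_inv, MonoidHom.pow_apply,
      MonoidHom.inv_apply, inv_pow, ← pow_mul, pow_add, mul_comm b a]
    rw [mul_mul_mul_comm, mul_inv_cancel, mul_one]
    rw [mul_mul_mul_comm, mul_comm (q x.2 ^ b ^ 2)]
  rw [sq, sq, Finset.sum_mul_sum, Finset.sum_mul_sum, ← Fintype.sum_prod_type',
    ← Fintype.sum_prod_type',
    ← Function.Bijective.sum_comp (Finite.injective_iff_bijective.1 hinj)]
  refine Finset.sum_congr rfl fun x _ => ?_
  rw [← Units.val_mul, hf, Units.val_mul]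

end MetricGroup

theorem exists_prime_pow_dvd_sq_add_one {p : ℕ} (hp : p.Prime) (h : p % 4 = 1) (k : ℕ) :
    ∃ a : ℕ, p ^ k ∣ a ^ 2 + 1 := by
  have := Fact.mk hp
  obtain ⟨y, hy⟩ := ZMod.exists_sq_eq_neg_one_iff.2 (show p % 4 ≠ 3 by omega)
  have hdvd : (p : ℤ) ∣ (y.val : ℤ) ^ 2 - (-1) := by
    rw [← ZMod.intCast_zmod_eq_zero_iff_dvd]
    push_cast
    rw [ZMod.natCast_zmod_val, hy]
    ring
  have hodd : Odd (p ^ k) := (Nat.odd_iff.2 (by omega)).pow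
  have hlift := (pow_dvd_pow (p : ℤ) k.le_succ).trans (dvd_sub_pow_of_dvd_sub hdvd k)
  refine ⟨y.val ^ p ^ k, ?_⟩
  rw [hodd.neg_one_pow, sub_neg_eq_add, pow_right_comm] at hlift
  exact_mod_cast hlift

theorem exists_dvd_sq_add_sq_add_one {n : ℕ} (hn : Odd n) :
    ∃ a b : ℕ, n ∣ a ^ 2 + b ^ 2 + 1 := by
  have hcop : Nat.Coprime 4 n := Nat.Coprime.pow_left 2 (Nat.coprime_two_left.2 hn)
  have hpos : 0 < n := hn.pos
  obtain ⟨c, hc4, hcn⟩ := Nat.chineseRemainder hcop 1 (n - 1)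
  have hc4' : c.Coprime 4 := by
    rw [Nat.Coprime, hc4.gcd_eq, Nat.gcd_one_left]
  have hcn' : c.Coprime n := by
    rw [Nat.Coprime, hcn.gcd_eq]
    exact (Nat.coprime_self_sub_left hpos).2 (Nat.coprime_one_left n)
  obtain ⟨l, -, hl, hlc⟩ := Nat.forall_exists_prime_gt_and_modEq 0
    (by positivity : 4 * n ≠ 0) (hc4'.mul_right hcn')
  have := Fact.mk hl
  have hl4 : l % 4 = 1 := (hlc.of_mul_right n).trans hc4
  obtain ⟨a, b, hab⟩ := Nat.Prime.sq_add_sq (p := l) (by omega)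
  refine ⟨a, b, ?_⟩
  rw [hab]
  have hln := ((hlc.of_mul_left 4).trans hcn).add_right 1
  rw [Nat.sub_add_cancel hpos] at hln
  exact (Nat.modEq_zero_iff_dvd.1 (hln.trans (by simp [Nat.ModEq])))

/-- Let `p` be an odd prime and `(G,q)` a nondegenerate metric
group with `G` a `p`-group. If `p ≡ 1 (mod 4)` then `(∑ q(g))² = |G|` (central
charge `±1`); if `p ≡ 3 (mod 4)` then `(∑ q(g))⁴ = |G|²` (central charge `±1` or
`±i`). -/
theorem p_group_gauss_sum_central_charge
    {G : Type*} [CommGroup G] [Fintype G] (q : G → ℂˣ)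
    (hq1 : ∀ g : G, q g⁻¹ = q g)
    (hq2 : ∀ g₁ g₂ h : G, metricForm q (g₁ * g₂) h = metricForm q g₁ h * metricForm q g₂ h)
    (hnd : ∀ g : G, (∀ h : G, metricForm q g h = 1) → g = 1)
    (p : ℕ) (hp : p.Prime) (hodd : Odd p) (hpG : IsPGroup p G) :
    (p % 4 = 1 → (∑ g : G, (q g : ℂ)) ^ 2 = (Fintype.card G : ℂ)) ∧
    (p % 4 = 3 → (∑ g : G, (q g : ℂ)) ^ 4 = (Fintype.card G : ℂ) ^ 2) := by
  have hB : ∀ g h, q (g * h) = q g * q h * metricFormHom q hq2 g h := fun g h => by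
    change q (g * h) = q g * q h * (q (g * h) * (q g)⁻¹ * (q h)⁻¹)
    rw [mul_assoc (q (g * h)), ← mul_inv, mul_left_comm, mul_inv_cancel, mul_one]
  have hmul := gauss_sum_mul_gauss_sum_inv hB hnd
  have := Fact.mk hp
  obtain ⟨k, hk⟩ := IsPGroup.iff_card.1 hpG
  rw [Nat.card_eq_fintype_card] at hk
  have hk2 : Fintype.card G ^ 2 = p ^ (k * 2) := by rw [hk, pow_mul]
  refine ⟨fun h => ?_, fun _ => ?_⟩
  · obtain ⟨a, ha⟩ := exists_prime_pow_dvd_sq_add_one hp h (k * 2)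
    rw [← hk2] at ha
    rw [sq]
    nth_rewrite 2 [gauss_sum_eq_gauss_sum_inv hB hq1 ha]
    exact hmul
  · obtain ⟨a, b, hab⟩ := exists_dvd_sq_add_sq_add_one (hodd.pow (n := k * 2))
    rw [← hk2] at hab
    rw [← hmul, mul_pow, ← gauss_sum_sq_eq_gauss_sum_inv_sq hB hq1 hab, ← pow_add]
end
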